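/- Consider the Cantor set 2^ℕ equipped with the metric of least difference. The least cardinality of a subset of 2^ℕ that does not have strong measure zero equals the cardinal 𝔢𝔮, defined as the least cardinality of a family F ⊆ ℕ^ℕ such that F is bounded (there is h ∈ ℕ^ℕ with f(n) ≤ h(n) for all but finitely many n, for every f ∈ F) and for every g ∈ ℕ^ℕ there is f ∈ F with f(n) ≠ g(n) for all n ∈ ℕ. -/

import Mathlib

open Set Filter Topology
open scoped ENNReal Pointwise

def SmzGroup {G : Type*} [Group G] [TopologicalSpace G] (S : Set G) : Prop :=
  ∀ U : ℕ → Set G, (∀ n, IsOpen (U n) ∧ (1 : G) ∈ U n) →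
    ∃ g : ℕ → G, S ⊆ ⋃ n, g n • U n

def SmzMetric {X : Type*} [PseudoEMetricSpace X] (S : Set X) : Prop :=
  ∀ ε : ℕ → ℝ, (∀ n, 0 < ε n) →
    ∃ U : ℕ → Set X, S ⊆ (⋃ n, U n) ∧ ∀ n, EMetric.diam (U n) ≤ ENNReal.ofReal (ε n)

structure Submeasure (G : Type*) where
  toFun : Set G → ℝ≥0∞
  empty' : toFun ∅ = 0
  mono' : ∀ ⦃A B : Set G⦄, A ⊆ B → toFun A ≤ toFun B
  subadd' : ∀ A B : Set G, toFun (A ∪ B) ≤ toFun A + toFun B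

instance {G : Type*} : CoeFun (Submeasure G) (fun _ => Set G → ℝ≥0∞) := ⟨Submeasure.toFun⟩

def Submeasure.LeftInvariant {G : Type*} [Group G] (μ : Submeasure G) : Prop :=
  ∀ (g : G) (A : Set G), μ (g • A) = μ A

def Submeasure.OuterRegular {G : Type*} [TopologicalSpace G] (μ : Submeasure G) : Prop :=
  ∀ A : Set G, μ A = ⨅ (U : Set G) (_ : A ⊆ U) (_ : IsOpen U), μ U

def Submeasure.SigmaSubadditive {G : Type*} (μ : Submeasure G) : Prop :=
  ∀ A : ℕ → Set G, μ (⋃ n, A n) ≤ ∑' n, μ (A n)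

def Submeasure.Diffuse {G : Type*} (μ : Submeasure G) : Prop :=
  ∀ x : G, μ {x} = 0

def UniformlyNowhereDense {G : Type*} [Group G] [TopologicalSpace G] (N : Set G) : Prop :=
  ∀ U ∈ 𝓝 (1 : G), ∃ V ∈ 𝓝 (1 : G), ∀ x : G, ∃ g : G, g • V ⊆ (x • U) \ N

def UniformlyMeager {G : Type*} [Group G] [TopologicalSpace G] (M : Set G) : Prop :=
  ∃ N : ℕ → Set G, (∀ n, UniformlyNowhereDense (N n)) ∧ M = ⋃ n, N n

def AntiGMS {G : Type*} [Group G] [TopologicalSpace G] (C : Set G) : Prop :=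
  C.Nonempty ∧ IsNowhereDense C ∧
    ∀ U : ℕ → Set G, (∀ n, IsOpen (U n) ∧ (1 : G) ∈ U n) →
      ∃ g : ℕ → G, ∀ x : G, C ⊆ closure (x • ⋃ n, g n • U n)

def HasInvariantMetric (G : Type*) [Group G] [t : TopologicalSpace G] : Prop :=
  ∃ m : MetricSpace G, m.toUniformSpace.toTopologicalSpace = t ∧
    (∀ x y z : G, m.toDist.dist (z * x) (z * y) = m.toDist.dist x y) ∧
    (∀ x y z : G, m.toDist.dist (x * z) (y * z) = m.toDist.dist x y)

def IsCLI (G : Type*) [Group G] [t : TopologicalSpace G] : Prop :=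
  ∃ m : MetricSpace G, m.toUniformSpace.toTopologicalSpace = t ∧
    (@CompleteSpace G m.toUniformSpace) ∧
    ∀ x y z : G, m.toDist.dist (z * x) (z * y) = m.toDist.dist x y

structure IsGauge (h : ℝ → ℝ) : Prop where
  nonneg : ∀ r, 0 ≤ r → 0 ≤ h r
  mono : MonotoneOn h (Set.Ici 0)
  rightCont : ∀ r : ℝ, 0 ≤ r → ContinuousWithinAt h (Set.Ioi r) r
  zero : h 0 = 0
  pos : ∀ r, 0 < r → 0 < h r

noncomputable def hausdorffH {X : Type*} [PseudoEMetricSpace X] (h : ℝ → ℝ) (E : Set X) : ℝ≥0∞ :=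
  ⨆ (δ : ℝ) (_ : 0 < δ),
    ⨅ (U : ℕ → Set X) (_ : E ⊆ ⋃ n, U n)
      (_ : ∀ n, EMetric.diam (U n) ≤ ENNReal.ofReal δ),
      ∑' n, ENNReal.ofReal (h (EMetric.diam (U n)).toReal)

noncomputable def upperH0 {X : Type*} [PseudoEMetricSpace X] (h : ℝ → ℝ) (E : Set X) : ℝ≥0∞ :=
  ⨆ (δ : ℝ) (_ : 0 < δ),
    ⨅ (N : ℕ) (U : ℕ → Set X) (_ : E ⊆ ⋃ n ∈ Finset.range N, U n)
      (_ : ∀ n ∈ Finset.range N, EMetric.diam (U n) ≤ ENNReal.ofReal δ),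
      ∑ n ∈ Finset.range N, ENNReal.ofReal (h (EMetric.diam (U n)).toReal)

noncomputable def upperH {X : Type*} [PseudoEMetricSpace X] (h : ℝ → ℝ) (E : Set X) : ℝ≥0∞ :=
  ⨅ (A : ℕ → Set X) (_ : E ⊆ ⋃ n, A n), ∑' n, upperH0 h (A n)

def IsGammaGroupableCover {X : Type*} (S : Set X) (U : ℕ → Set X) : Prop :=
  ∃ k : ℕ → ℕ, k 0 = 0 ∧ StrictMono k ∧
    ∀ x ∈ S, ∀ᶠ j in Filter.atTop, ∃ n, k j ≤ n ∧ n < k (j + 1) ∧ x ∈ U n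

def SmzSharp {X : Type*} [PseudoEMetricSpace X] (S : Set X) : Prop :=
  ∀ ε : ℕ → ℝ, (∀ n, 0 < ε n) →
    ∃ U : ℕ → Set X, IsGammaGroupableCover S U ∧
      ∀ n, EMetric.diam (U n) ≤ ENNReal.ofReal (ε n)

noncomputable def covMeager (X : Type*) [TopologicalSpace X] : Cardinal :=
  sInf {c : Cardinal | ∃ 𝒜 : Set (Set X),
    (∀ A ∈ 𝒜, IsMeagre A) ∧ ⋃₀ 𝒜 = Set.univ ∧ Cardinal.mk ↥𝒜 = c}

noncomputable def eqCard : Cardinal :=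
  sInf {c : Cardinal | ∃ F : Set (ℕ → ℕ),
    (∃ h : ℕ → ℕ, ∀ f ∈ F, ∀ᶠ n in Filter.atTop, f n ≤ h n) ∧
    (∀ g : ℕ → ℕ, ∃ f ∈ F, ∀ n, f n ≠ g n) ∧ Cardinal.mk ↥F = c}

attribute [local instance] PiNat.metricSpace

theorem edist_le_iff_agree (x y : ℕ → Bool) (N : ℕ) :
    edist x y ≤ ENNReal.ofReal ((1 / 2) ^ N) ↔ ∀ i < N, x i = y i := by
  rw [edist_dist, ENNReal.ofReal_le_ofReal_iff (by positivity)]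
  exact (PiNat.mem_cylinder_iff_dist_le (E := fun _ => Bool) (x := y) (y := x) (n := N)).symm

/-- A strong measure zero set is covered infinitely often. -/
theorem SmzMetric.frequently {S : Set (ℕ → Bool)} (hS : SmzMetric S)
    (ε : ℕ → ℝ) (hε : ∀ n, 0 < ε n) :
    ∃ U : ℕ → Set (ℕ → Bool), (∀ x ∈ S, ∀ m, ∃ n ≥ m, x ∈ U n) ∧
      ∀ n, EMetric.diam (U n) ≤ ENNReal.ofReal (ε n) := by
  have h := fun m => hS (fun j => ε (Nat.pair m j)) (fun j => hε _)
  choose V hV hd using h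
  refine ⟨fun n => V n.unpair.1 n.unpair.2, fun x hx m => ?_, fun n => ?_⟩
  · obtain ⟨j, hj⟩ := mem_iUnion.1 (hV m hx)
    exact ⟨Nat.pair m j, Nat.left_le_pair m j, by simpa using hj⟩
  · simpa using hd n.unpair.1 n.unpair.2

/-- The code of a function as a binary sequence. -/
def codeFun (f : ℕ → ℕ) : ℕ → Bool := fun p => (f p.unpair.1).testBit p.unpair.2

theorem not_smz_of_family (F : Set (ℕ → ℕ)) (h : ℕ → ℕ)
    (hF : ∀ f ∈ F, ∀ᶠ n in Filter.atTop, f n ≤ h n)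
    (hg : ∀ g : ℕ → ℕ, ∃ f ∈ F, ∀ n, f n ≠ g n) : ¬ SmzMetric (codeFun '' F) := by
  intro hS
  obtain ⟨U, hU, hd⟩ := hS.frequently (fun n => (1 / 2) ^ (Nat.pair n (h n) + 1))
    (fun n => by positivity)
  have key : ∀ n f f', codeFun f ∈ U n → codeFun f' ∈ U n → f n ≤ h n → f' n ≤ h n →
      f n = f' n := by
    intro n f f' hf hf' hn hn'
    have h1 := (edist_le_iff_agree _ _ _).1
      ((Metric.edist_le_ediam_of_mem hf hf').trans (hd n))
    apply Nat.eq_of_testBit_eq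
    intro i
    rcases le_or_gt i (h n) with hi | hi
    · have hp : Nat.pair n i ≤ Nat.pair n (h n) := by
        rcases hi.eq_or_lt with rfl | hi
        · exact le_rfl
        · exact (Nat.pair_lt_pair_right n hi).le
      have := h1 (Nat.pair n i) (by omega)
      simpa [codeFun] using this
    · have h2 : i < 2 ^ i := Nat.lt_two_pow_self
      rw [Nat.testBit_lt_two_pow (by omega), Nat.testBit_lt_two_pow (by omega)]
  have hgex : ∀ n, ∃ v : ℕ, ∀ f ∈ F, codeFun f ∈ U n → f n ≤ h n → f n = v := by
    intro n
    by_cases hex : ∃ f ∈ F, codeFun f ∈ U n ∧ f n ≤ h n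
    · obtain ⟨f, -, hf, hn⟩ := hex
      exact ⟨f n, fun f' _ hf' hn' => key n f' f hf' hf hn' hn⟩
    · exact ⟨0, fun f' h1 h2 h3 => absurd ⟨f', h1, h2, h3⟩ hex⟩
  choose g hgg using hgex
  obtain ⟨f, hf, hne⟩ := hg g
  obtain ⟨m, hm⟩ := eventually_atTop.1 (hF f hf)
  obtain ⟨n, hn, hfn⟩ := hU _ (mem_image_of_mem _ hf) m
  exact hne n (hgg n f hf hfn (hm n hn))

/-- The code of the first `N` bits of a binary sequence. -/
noncomputable def bitsCode (N : ℕ) (x : ℕ → Bool) : ℕ :=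
  (Fintype.equivFin (Fin N → Bool) (fun i => x i) : ℕ)

theorem bitsCode_agree {N : ℕ} {x y : ℕ → Bool} (h : bitsCode N x = bitsCode N y) :
    ∀ i < N, x i = y i := by
  intro i hi
  have h1 := (Fintype.equivFin (Fin N → Bool)).injective (Fin.ext h)
  exact congrFun h1 ⟨i, hi⟩

theorem family_of_not_smz (S : Set (ℕ → Bool)) (hS : ¬ SmzMetric S) :
    ∃ N : ℕ → ℕ, ∀ g : ℕ → ℕ, ∃ x ∈ S, ∀ n, bitsCode (N n) x ≠ g n := by
  unfold SmzMetric at hS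
  push Not at hS
  obtain ⟨ε, hε, hS⟩ := hS
  have hN : ∀ n, ∃ N : ℕ, ((1 : ℝ) / 2) ^ N < ε n := fun n =>
    exists_pow_lt_of_lt_one (hε n) (by norm_num)
  choose N hN using hN
  refine ⟨N, fun g => ?_⟩
  by_contra hcon
  push Not at hcon
  obtain ⟨n, hn⟩ := hS (fun n => {x | bitsCode (N n) x = g n}) (by
    intro x hx
    exact mem_iUnion.2 (hcon x hx))
  refine absurd hn (not_lt.2 ?_)
  refine Metric.ediam_le fun x hx y hy => ?_
  refine le_trans ((edist_le_iff_agree x y (N n)).2 (bitsCode_agree ?_))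
    (ENNReal.ofReal_le_ofReal (hN n).le)
  exact Eq.trans hx (Eq.symm hy)

/-- `non(Smz(2^ℕ)) = 𝔢𝔮` for the Cantor set with the least-difference metric. -/
theorem non_smz_cantor_eq_eqCard :
    sInf {c : Cardinal | ∃ S : Set (ℕ → Bool), ¬ SmzMetric S ∧ Cardinal.mk ↥S = c} =
      eqCard := by
  have hne : {c : Cardinal | ∃ F : Set (ℕ → ℕ),
      (∃ h : ℕ → ℕ, ∀ f ∈ F, ∀ᶠ n in Filter.atTop, f n ≤ h n) ∧
      (∀ g : ℕ → ℕ, ∃ f ∈ F, ∀ n, f n ≠ g n) ∧ Cardinal.mk ↥F = c}.Nonempty := by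
    refine ⟨_, {f | ∀ n, f n ≤ 1}, ⟨fun _ => 1, fun f hf => Eventually.of_forall hf⟩,
      fun g => ⟨fun n => if g n = 0 then 1 else 0, fun n => ?_, fun n => ?_⟩, rfl⟩
    · dsimp only
      split_ifs <;> omega
    · dsimp only
      split_ifs <;> omega
  apply le_antisymm
  · refine le_csInf hne ?_
    rintro c ⟨F, ⟨h, hF⟩, hg, rfl⟩
    exact le_trans (csInf_le' ⟨_, not_smz_of_family F h hF hg, rfl⟩) Cardinal.mk_image_le
  · refine le_csInf ?_ ?_
    · obtain ⟨c, F, ⟨h, hF⟩, hg, -⟩ := hne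
      exact ⟨_, _, not_smz_of_family F h hF hg, rfl⟩
    · rintro c ⟨S, hS, rfl⟩
      obtain ⟨N, hN⟩ := family_of_not_smz S hS
      unfold eqCard
      refine le_trans (csInf_le' ⟨(fun x n => bitsCode (N n) x) '' S,
        ⟨fun n => Fintype.card (Fin (N n) → Bool), ?_⟩, fun g => ?_, rfl⟩)
          Cardinal.mk_image_le
      · rintro f ⟨x, -, rfl⟩
        exact Eventually.of_forall fun n => (Fin.is_lt _).le
      · obtain ⟨x, hx, hxg⟩ := hN g
        exact ⟨_, mem_image_of_mem _ hx, hxg⟩
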